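/- arXiv:2405.18388 — 11 statements merged into one kernel-verified Lean document; each statement's English description precedes it below -/
import Mathlib

section
/- The integers ℤ, equipped with the element 0 and the successor bijection x ↦ x + 1, form an initial integer algebra: for every type B, every element b : B, and every bijection e : B → B, there is exactly one function f : ℤ → B such that f 0 = b and f (x + 1) = e (f x) for all x : ℤ. -/
/-- The integers `ℤ`, equipped with the element `0` and the successor bijection
`x ↦ x + 1`, form an initial integer algebra: for every type `B`, every element
`b : B`, and every bijection `e : B → B`, there is exactly one function
`f : ℤ → B` with `f 0 = b` and `f (x + 1) = e (f x)` for all `x : ℤ`. -/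
theorem int_initial_integer_algebra :
    ∀ (B : Type) (b : B) (e : B → B), Function.Bijective e →
      ∃! f : ℤ → B, f 0 = b ∧ ∀ x : ℤ, f (x + 1) = e (f x) := by
  intro B b e he
  let σ : Equiv.Perm B := Equiv.ofBijective e he
  refine ⟨fun n => (σ ^ n) b, ⟨by simp, fun x => ?_⟩, ?_⟩
  · change (σ ^ (x + 1)) b = σ ((σ ^ x) b)
    rw [add_comm, zpow_one_add, Equiv.Perm.mul_apply]
  · rintro g ⟨hg_zero, hg_succ⟩
    funext n
    induction n using Int.induction_on with
    | zero => simp [hg_zero]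
    | succ n ih =>
      rw [hg_succ, ih, add_comm, zpow_one_add]
      rfl
    | pred n ih =>
      apply he.injective
      rw [← hg_succ, sub_add_cancel, ih]
      change _ = σ ((σ ^ (-(n : ℤ) - 1)) b)
      rw [← Equiv.Perm.mul_apply, ← zpow_one_add, add_sub_cancel]
end

section
/- If there exists an initial integer algebra, then there exists an initial natural number algebra: a type N with an element zN : N and a function sN : N → N such that for every type B with b : B and g : B → B there is exactly one function f : N → B with f zN = b and f (sN n) = g (f n) for all n : N. -/
/-- The points reachable from `z₀` by iterating `S`. -/
inductive Reachable {Z : Type} (z₀ : Z) (S : Z → Z) : Z → Prop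
  | base : Reachable z₀ S z₀
  | step {x : Z} : Reachable z₀ S x → Reachable z₀ S (S x)

/-- The graph of the function defined by recursion along `S` from `z₀`, with data `b` and `g`. -/
inductive RecGraph {Z B : Type} (z₀ : Z) (S : Z → Z) (b : B) (g : B → B) : Z → B → Prop
  | base : RecGraph z₀ S b g z₀ b
  | step {x : Z} {y : B} : RecGraph z₀ S b g x y → RecGraph z₀ S b g (S x) (g y)

theorem RecGraph.reachable {Z B : Type} {z₀ : Z} {S : Z → Z} {b : B} {g : B → B} {x : Z} {y : B}
    (h : RecGraph z₀ S b g x y) : Reachable z₀ S x := by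
  induction h with
  | base => exact .base
  | step _ ih => exact ih.step

/-- In a weakly initial integer algebra, the base point is not a successor of a reachable point:
otherwise, inserting an extra point `none` in the cycle through `z₀` gives an integer algebra
which receives no morphism. -/
theorem Reachable.succ_ne_base {Z : Type} {z₀ : Z} {S : Z → Z} (hS : Function.Bijective S)
    (hZ : ∀ (B : Type) (b : B) (e : B → B), Function.Bijective e →
      ∃ f : Z → B, f z₀ = b ∧ ∀ x : Z, f (S x) = e (f x))
    {n : Z} (hn : Reachable z₀ S n) : S n ≠ z₀ := by
  classical
  intro hn₀
  let e : Equiv.Perm (Option Z) :=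
    (Equiv.swap (some n) none).trans (Equiv.optionCongr (Equiv.ofBijective S hS))
  have he : e (some n) = none := by simp [e]
  have he' (x : Z) (hx : x ≠ n) : e (some x) = some (S x) := by
    simp [e, Equiv.swap_apply_of_ne_of_ne, hx]
  obtain ⟨f, hf₀, hf⟩ := hZ (Option Z) (some z₀) e e.bijective
  have key (x : Z) (hx : Reachable z₀ S x) : f x = some x := by
    induction hx with
    | base => exact hf₀
    | @step x _ ih =>
      by_cases hxn : x = n
      · rw [hxn, hn₀, hf₀]
      · rw [hf, ih, he' x hxn]
  have hnone : f (S n) = none := by rw [hf, key n hn, he]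
  rw [hn₀, hf₀] at hnone
  exact Option.some_ne_none _ hnone

theorem RecGraph.existsUnique {Z B : Type} {z₀ : Z} {S : Z → Z} (hS : Function.Injective S)
    (hz : ∀ x, Reachable z₀ S x → S x ≠ z₀) (b : B) (g : B → B) {x : Z}
    (hx : Reachable z₀ S x) : ∃! y, RecGraph z₀ S b g x y := by
  induction hx with
  | base =>
    refine ⟨b, .base, fun y hy => ?_⟩
    generalize hw : z₀ = w at hy
    cases hy with
    | base => rfl
    | step h => exact absurd hw.symm (hz _ (hw ▸ h.reachable))
  | @step x hx ih =>
    obtain ⟨y, hy, huniq⟩ := ih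
    refine ⟨g y, hy.step, fun y' hy' => ?_⟩
    generalize hw : S x = w at hy'
    cases hy' with
    | base => exact absurd hw (hz x hx)
    | step h =>
      obtain rfl := hS hw
      rw [huniq _ h]

/-- If there exists an initial integer algebra, then there exists an initial
natural number algebra. -/
theorem initial_nat_algebra_of_initial_integer_algebra
    (h : ∃ (Z : Type) (z₀ : Z) (S : Z → Z), Function.Bijective S ∧
      ∀ (B : Type) (b : B) (e : B → B), Function.Bijective e →
        ∃! f : Z → B, f z₀ = b ∧ ∀ x : Z, f (S x) = e (f x)) :
    ∃ (N : Type) (zN : N) (sN : N → N),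
      ∀ (B : Type) (b : B) (g : B → B),
        ∃! f : N → B, f zN = b ∧ ∀ n : N, f (sN n) = g (f n) := by
  obtain ⟨Z, z₀, S, hS, hZ⟩ := h
  have hz (x : Z) (hx : Reachable z₀ S x) : S x ≠ z₀ :=
    hx.succ_ne_base hS fun B b e he => (hZ B b e he).exists
  refine ⟨{x // Reachable z₀ S x}, ⟨z₀, .base⟩, fun n => ⟨S n, n.2.step⟩, fun B b g => ?_⟩
  have hR (n : {x // Reachable z₀ S x}) : ∃! y, RecGraph z₀ S b g n y :=
    RecGraph.existsUnique hS.injective hz b g n.2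
  choose f hf huniq using hR
  refine ⟨f, ⟨(huniq _ _ .base).symm, fun n => (huniq _ _ (hf n).step).symm⟩, ?_⟩
  rintro f' ⟨hf'₀, hf'⟩
  funext ⟨x, hx⟩
  apply huniq
  induction hx with
  | base => exact hf'₀ ▸ .base
  | step hx ih => exact hf' ⟨_, hx⟩ ▸ ih.step
end

section
/- A natural number algebra (A, z, s) is initial if and only if it has elimination: for every natural number algebra (B, z', s') there is exactly one function f : A → B with f z = z' and f (s a) = s' (f a) for all a, if and only if for every family P : A → Type with p₀ : P z and ps : ∀ a, P a → P (s a) there exists g : ∀ a, P a with g z = p₀ and g (s a) = ps a (g a) for all a : A. -/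
/-- A natural number algebra is initial if and only if it has elimination. -/
theorem nat_algebra_initial_iff_elim
    (A : Type) (z : A) (s : A → A) :
    (∀ (B : Type) (z' : B) (s' : B → B),
        ∃! f : A → B, f z = z' ∧ ∀ a : A, f (s a) = s' (f a)) ↔
    (∀ (P : A → Type) (p₀ : P z) (ps : ∀ a : A, P a → P (s a)),
        ∃ g : ∀ a : A, P a, g z = p₀ ∧ ∀ a : A, g (s a) = ps a (g a)) := by
  constructor
  · intro initial P p₀ ps
    -- The total space of `P` is an algebra, and its first projection is a morphism.
    obtain ⟨f, ⟨hz, hs⟩, -⟩ := initial (Σ a, P a) ⟨z, p₀⟩ fun x => ⟨s x.1, ps x.1 x.2⟩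
    have fst_eq : (fun a => (f a).1) = id :=
      (initial A z s).unique ⟨by rw [hz], fun a => by rw [hs]⟩ ⟨rfl, fun _ => rfl⟩
    have exists_section : ∀ a, ∃ p : P a, f a = ⟨a, p⟩ := fun a => by
      have h : (f a).1 = a := congrFun fst_eq a
      generalize f a = x at h
      subst h
      exact ⟨x.2, rfl⟩
    choose g hg using exists_section
    refine ⟨g, ?_, fun a => ?_⟩
    · exact eq_of_heq (Sigma.mk.inj ((hg z).symm.trans hz)).2
    · have h := hs a
      rw [hg, hg] at h
      exact eq_of_heq (Sigma.mk.inj h).2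
  · intro elim B z' s'
    obtain ⟨f, hz, hs⟩ := elim (fun _ => B) z' fun _ => s'
    refine ⟨f, ⟨hz, hs⟩, fun f' ⟨hz', hs'⟩ => funext fun a => ?_⟩
    obtain ⟨g, -⟩ := elim (fun a => PLift (f' a = f a)) ⟨hz'.trans hz.symm⟩
      fun a h => ⟨by rw [hs, hs', h.down]⟩
    exact (g a).down
end

section
/- An integer algebra (Z, z₀, S) is initial if and only if it has integer elimination: for every integer algebra (B, b, e) there is exactly one function f : Z → B with f z₀ = b and f (S x) = e (f x) for all x, if and only if for every family P : Z → Type with p₀ : P z₀ and functions ps : ∀ x, P x → P (S x) each of which is a bijection, there exists g : ∀ x, P x with g z₀ = p₀ and g (S x) = ps x (g x) for all x : Z. -/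
/-- An integer algebra is initial if and only if it has integer elimination. -/
theorem integer_algebra_initial_iff_elim
    (Z : Type) (z₀ : Z) (S : Z → Z) (hS : Function.Bijective S) :
    (∀ (B : Type) (b : B) (e : B → B), Function.Bijective e →
        ∃! f : Z → B, f z₀ = b ∧ ∀ x : Z, f (S x) = e (f x)) ↔
    (∀ (P : Z → Type) (p₀ : P z₀) (ps : ∀ x : Z, P x → P (S x)),
        (∀ x : Z, Function.Bijective (ps x)) →
        ∃ g : ∀ x : Z, P x, g z₀ = p₀ ∧ ∀ x : Z, g (S x) = ps x (g x)) := by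
  constructor
  · intro initial P p₀ ps hps
    have bij : Function.Bijective (Sigma.map S ps) :=
      ⟨hS.1.sigma_map fun x => (hps x).1, hS.2.sigma_map fun x => (hps x).2⟩
    obtain ⟨f, ⟨hf₀, hfS⟩, -⟩ := initial (Σ x, P x) ⟨z₀, p₀⟩ (Sigma.map S ps) bij
    have fst_f : (fun x => (f x).1) = id :=
      (initial Z z₀ S hS).unique
        ⟨congrArg Sigma.fst hf₀, fun x => congrArg Sigma.fst (hfS x)⟩
        ⟨rfl, fun _ => rfl⟩
    have lift (x : Z) : ∃ p : P x, f x = ⟨x, p⟩ := by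
      have fst_eq : (f x).1 = x := congrFun fst_f x
      exact ⟨fst_eq ▸ (f x).2, Sigma.ext fst_eq (by simp)⟩
    choose g hg using lift
    refine ⟨g, sigma_mk_injective ((hg z₀).symm.trans hf₀), fun x => sigma_mk_injective ?_⟩
    rw [← hg (S x), hfS x, hg x, Sigma.map]
  · intro elim B b e he
    obtain ⟨f, hf⟩ := elim (fun _ => B) b (fun _ => e) fun _ => he
    refine ⟨f, hf, fun f' hf' => funext ?_⟩
    have step (x : Z) : f' x = f x ↔ f' (S x) = f (S x) := by
      rw [hf.2, hf'.2, he.1.eq_iff]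
    obtain ⟨g, -⟩ := elim (fun x => PLift (f' x = f x)) ⟨hf'.1.trans hf.1.symm⟩
      (fun x p => ⟨(step x).1 p.down⟩) fun x =>
        ⟨fun _ _ _ => Subsingleton.elim _ _,
          fun q => ⟨⟨(step x).2 q.down⟩, Subsingleton.elim _ _⟩⟩
    exact fun x => (g x).down
end

section
/- Splitting the integers into even and odd parts: let (Z, z₀, S) be an initial integer algebra and let d : Z → Z be a function satisfying d z₀ = z₀ and d (S x) = S (S (d x)) for all x : Z. Then the map Z ⊕ Z → Z sending inl x to d x and inr x to S (d x) is a bijection. -/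
/-- The successor on `Z ⊕ Z` when its summands are read as the even and the odd integers. -/
def interleave {Z : Type*} (S : Z → Z) : Z ⊕ Z → Z ⊕ Z :=
  Sum.elim Sum.inr (fun x => Sum.inl (S x))

theorem interleave_bijective {Z : Type*} {S : Z → Z} (hS : Function.Bijective S) :
    Function.Bijective (interleave S) := by
  constructor
  · rintro (x | x) (y | y) h <;> simp_all [interleave, hS.injective.eq_iff]
  · rintro (y | y)
    · obtain ⟨x, rfl⟩ := hS.surjective y
      exact ⟨Sum.inr x, rfl⟩
    · exact ⟨Sum.inl y, rfl⟩

/-- Splitting the integers into even and odd parts: if `d` doubles in an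
initial integer algebra, then `[d, S ∘ d] : Z ⊕ Z → Z` is a bijection. -/
theorem split_even_odd
    (Z : Type) (z₀ : Z) (S : Z → Z) (hS : Function.Bijective S)
    (init : ∀ (B : Type) (b : B) (e : B → B), Function.Bijective e →
      ∃! f : Z → B, f z₀ = b ∧ ∀ x : Z, f (S x) = e (f x))
    (d : Z → Z) (hd0 : d z₀ = z₀) (hdS : ∀ x : Z, d (S x) = S (S (d x))) :
    Function.Bijective (Sum.elim d (fun x => S (d x)) : Z ⊕ Z → Z) := by
  have hT := interleave_bijective hS
  obtain ⟨g, ⟨hg0, hgS⟩, -⟩ := init (Z ⊕ Z) (Sum.inl z₀) (interleave S) hT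
  have hm : ∀ y, Sum.elim d (fun x => S (d x)) (interleave S y) =
      S (Sum.elim d (fun x => S (d x)) y) := by
    rintro (x | x)
    · rfl
    · exact hdS x
  have right_inv : (fun x => Sum.elim d (fun x => S (d x)) (g x)) = id :=
    (init Z z₀ S hS).unique ⟨by simp [hg0, hd0], fun x => by simp only [hgS, hm]⟩
      ⟨rfl, fun _ => rfl⟩
  have hgd : (fun x => g (d x)) = Sum.inl :=
    (init (Z ⊕ Z) (Sum.inl z₀) (interleave S ∘ interleave S) (hT.comp hT)).unique
      ⟨by simp only [hd0, hg0], fun x => by simp only [hdS, hgS, Function.comp_apply]⟩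
      ⟨rfl, fun _ => rfl⟩
  refine Function.bijective_iff_has_inverse.mpr ⟨g, ?_, congrFun right_inv⟩
  rintro (x | x)
  · exact congrFun hgd x
  · exact (hgS (d x)).trans (congrArg (interleave S) (congrFun hgd x))
end

section
/- Free generation of a prefix algebra bounded in the integers: let (Z, z₀, S) be an initial integer algebra and lt : Z → Z → Prop a relation such that (i) lt x y implies lt x (S y), (ii) lt (S x) (S y) implies lt x y, and (iii) lt x (S x) for all x. Let Y and M be types, ι : Y → M and s : M → M functions such that the map Y ⊕ M → M sending inl y to ι y and inr m to s m is a bijection, and let j : M → Z satisfy j (s m) = S (j m) and ¬ lt (j m) z₀ for all m : M. Then for every family A : M → Type with zA : ∀ y, A (ι y) and sA : ∀ m, A m → A (s m), there exists g : ∀ m, A m such that g (ι y) = zA y for all y : Y and g (s m) = sA m (g m) for all m : M. -/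
/-- An initial integer algebra admits a map to `ℤ` that commutes with successors and is nonnegative
at every element not below the base point, where `lt x (S x)` holds and `lt x` is
closed under successors. -/
theorem exists_rank_of_initial {Z : Type} {z₀ : Z} {S : Z → Z} (hS : Function.Bijective S)
    (init : ∀ (B : Type) (b : B) (e : B → B), Function.Bijective e →
      ∃! f : Z → B, f z₀ = b ∧ ∀ x : Z, f (S x) = e (f x))
    {lt : Z → Z → Prop} (lt_S_right : ∀ x y : Z, lt x y → lt x (S y))
    (lt_S_self : ∀ x : Z, lt x (S x)) :
    ∃ f : Z → ℤ, (∀ x, f (S x) = f x + 1) ∧ ∀ x, ¬ lt x z₀ → 0 ≤ f x := by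
  obtain ⟨f, ⟨hf₀, hfS⟩, -⟩ := init ℤ 0 (· + 1) (Equiv.addRight (1 : ℤ)).bijective
  refine ⟨f, hfS, fun x hx ↦ ?_⟩
  let σ : Equiv.Perm Z := Equiv.ofBijective S hS
  have hσ : ∀ x, (σ ^ f x) z₀ = x := by
    refine congrFun ((init Z z₀ S hS).unique (y₁ := fun x ↦ (σ ^ f x) z₀) (y₂ := id)
      ⟨by simp [hf₀], fun x ↦ ?_⟩ ⟨rfl, fun _ ↦ rfl⟩)
    simp only [hfS, add_comm (f x), zpow_add, zpow_one, Equiv.Perm.mul_apply]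
    rfl
  have lt_iterate : ∀ n : ℕ, lt x ((σ ^ (n + 1)) x) := by
    intro n
    induction n with
    | zero => simpa [σ] using lt_S_self x
    | succ n ih =>
      rw [pow_succ', Equiv.Perm.mul_apply]
      exact lt_S_right _ _ ih
  by_contra! hneg
  obtain ⟨n, hn⟩ : ∃ n : ℕ, ((n + 1 : ℕ) : ℤ) = -f x := ⟨(-f x - 1).toNat, by omega⟩
  apply hx
  have hz : (σ ^ (n + 1)) x = z₀ := by
    rw [← zpow_natCast, hn, zpow_neg, Equiv.Perm.inv_eq_iff_eq, hσ]
  exact hz ▸ lt_iterate n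

/-- Dependent elimination for a free prefix algebra whose successor increases a rank. -/
theorem exists_elim_of_rank {Y M : Type*} {ι : Y → M} {s : M → M}
    (hfree : Function.Bijective (Sum.elim ι s : Y ⊕ M → M))
    (r : M → ℕ) (hr : ∀ m, r m < r (s m))
    {A : M → Type*} (zA : ∀ y : Y, A (ι y)) (sA : ∀ m : M, A m → A (s m)) :
    ∃ g : ∀ m : M, A m,
      (∀ y : Y, g (ι y) = zA y) ∧ ∀ m : M, g (s m) = sA m (g m) := by
  choose c hc using hfree.surjective
  let step (m : M) (ih : ∀ k, r k < r m → A k) (x : Y ⊕ M) (hx : Sum.elim ι s x = m) : A m :=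
    match x, hx with
    | .inl y, hx => hx ▸ zA y
    | .inr k, hx => hx ▸ sA k (ih k (hx ▸ hr k))
  let wf := (measure r).wf
  let g : ∀ m, A m := wf.fix fun m ih ↦ step m ih (c m) (hc m)
  have hg (m : M) : g m = step m (fun k _ ↦ g k) (c m) (hc m) := wf.fix_eq _ m
  have hg' (x : Y ⊕ M) :
      g (Sum.elim ι s x) = step (Sum.elim ι s x) (fun k _ ↦ g k) x rfl := by
    have step_congr : ∀ y (hy : Sum.elim ι s y = Sum.elim ι s x), y = x →
        step _ (fun k _ ↦ g k) y hy = step _ (fun k _ ↦ g k) x rfl := by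
      rintro _ _ rfl
      rfl
    rw [hg]
    exact step_congr _ (hc _) (hfree.injective (hc _))
  exact ⟨g, fun y ↦ hg' (.inl y), fun m ↦ hg' (.inr m)⟩


/-- Free generation of a prefix algebra bounded in the integers. -/
theorem prefix_algebra_elim
    (Z : Type) (z₀ : Z) (S : Z → Z) (hS : Function.Bijective S)
    (init : ∀ (B : Type) (b : B) (e : B → B), Function.Bijective e →
      ∃! f : Z → B, f z₀ = b ∧ ∀ x : Z, f (S x) = e (f x))
    (lt : Z → Z → Prop)
    (lt_S_right : ∀ x y : Z, lt x y → lt x (S y))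
    (lt_of_lt_S : ∀ x y : Z, lt (S x) (S y) → lt x y)
    (lt_S_self : ∀ x : Z, lt x (S x))
    (Y M : Type) (ι : Y → M) (s : M → M)
    (hfree : Function.Bijective (Sum.elim ι s : Y ⊕ M → M))
    (j : M → Z)
    (hjs : ∀ m : M, j (s m) = S (j m))
    (hjz : ∀ m : M, ¬ lt (j m) z₀)
    (A : M → Type) (zA : ∀ y : Y, A (ι y)) (sA : ∀ m : M, A m → A (s m)) :
    ∃ g : ∀ m : M, A m,
      (∀ y : Y, g (ι y) = zA y) ∧ ∀ m : M, g (s m) = sA m (g m) := by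
  obtain ⟨f, hfS, hf⟩ := exists_rank_of_initial hS init lt_S_right lt_S_self
  refine exists_elim_of_rank hfree (fun m ↦ (f (j m)).toNat) (fun m ↦ ?_) zA sA
  have := hf _ (hjz m)
  simp only [hjs, hfS]
  omega
end

section
/- Rectification of a free algebra with nullary constructors into a natural number type: let Y be a type with an element z : Y, and let X be a type with functions ι : Y → X and s : X → X having elimination, i.e. for every family P : X → Type with pι : ∀ y, P (ι y) and ps : ∀ x, P x → P (s x) there exists g : ∀ x, P x with g (ι y) = pι y and g (s x) = ps x (g x). Let r : X → X satisfy r (ι y) = ι z for all y : Y and r (s x) = s (r x) for all x : X. Then the subtype N := {x : X // r x = x}, with zero element given by ι z (a fixed point of r since r (ι z) = ι z) and successor sending a fixed point ⟨x, p⟩ to ⟨s x, _⟩ (using r (s x) = s (r x) = s x), is an initial natural number algebra. -/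
/-- Rectification of a free algebra with nullary constructors into a natural
number type: the fixed points of `r` form an initial natural number algebra. -/
theorem rectify_nat
    (Y : Type) (z : Y) (X : Type) (ι : Y → X) (s : X → X)
    (elim : ∀ (P : X → Type) (pι : ∀ y : Y, P (ι y))
      (ps : ∀ x : X, P x → P (s x)),
      ∃ g : ∀ x : X, P x, (∀ y : Y, g (ι y) = pι y) ∧
        ∀ x : X, g (s x) = ps x (g x))
    (r : X → X)
    (hrι : ∀ y : Y, r (ι y) = ι z)
    (hrs : ∀ x : X, r (s x) = s (r x)) :
    ∀ (B : Type) (b : B) (g : B → B),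
      ∃! f : {x : X // r x = x} → B,
        f ⟨ι z, hrι z⟩ = b ∧
        ∀ p : {x : X // r x = x},
          f ⟨s p.1, (hrs p.1).trans (congrArg s p.2)⟩ = g (f p) := by
  have ind : ∀ Q : X → Prop, (∀ y, Q (ι y)) → (∀ x, Q x → Q (s x)) → ∀ x, Q x := by
    intro Q hι hs x
    obtain ⟨q, -⟩ := elim (fun x => PLift (Q x)) (fun y => ⟨hι y⟩) (fun x hx => ⟨hs x hx.down⟩)
    exact (q x).down
  have idem : ∀ x, r (r x) = r x := by
    refine ind _ (fun y => ?_) (fun x hx => ?_)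
    · rw [hrι y, hrι z]
    · rw [hrs x, hrs (r x), hx]
  intro B b g
  obtain ⟨h, h_ι, h_s⟩ := elim (fun _ => B) (fun _ => b) (fun _ => g)
  refine ⟨fun p => h p.1, ⟨h_ι z, fun p => h_s p.1⟩, ?_⟩
  rintro f ⟨f_zero, f_succ⟩
  have key : ∀ x, ∀ q : {x : X // r x = x}, q.1 = r x → f q = h q.1 := by
    refine ind _ (fun y => ?_) (fun x hx => ?_)
    · rintro ⟨q, hq⟩ hqy
      obtain rfl : q = ι z := hqy.trans (hrι y)
      exact f_zero.trans (h_ι z).symm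
    · rintro ⟨q, hq⟩ hqx
      obtain rfl : q = s (r x) := hqx.trans (hrs x)
      exact (f_succ ⟨r x, idem x⟩).trans
        ((congrArg g (hx ⟨r x, idem x⟩ rfl)).trans (h_s (r x)).symm)
  exact funext fun p => key p.1 p p.2.symm
end

section
/- Recursive vectors over a counting algebra: let (A, z, s) be a natural number algebra with a counting structure. Then there exist: a family M : A → Type such that M z has exactly one element; for each x : A a bijection pair x : M x × A → M (s x); functions last : ∀ x, M x → Unit ⊕ A such that last z m = inl _ for every m : M z and last (s x) (pair x (m, y)) = inr y for all x : A, m : M x, y : A; and functions rest : ∀ x, M x → M x such that rest (s x) (pair x (m, y)) = pair x (rest x m, next x m) for all x, m, y, where next x m : A denotes the result of applying the map Unit ⊕ A → A sending inl _ to z and inr a to s a to last x m. -/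
/-- The first entry of a list, if there is one. -/
def lastEntry {A : Type} : List A → Unit ⊕ A
  | [] => Sum.inl ()
  | y :: _ => Sum.inr y

/-- Replace each entry of a list by the `s`-image of the entry following it, the final entry
being replaced by `z`. -/
def shiftEntries {A : Type} (z : A) (s : A → A) : List A → List A
  | [] => []
  | _ :: l => Sum.elim (fun _ : Unit => z) s (lastEntry l) :: shiftEntries z s l

theorem length_shiftEntries {A : Type} (z : A) (s : A → A) (l : List A) :
    (shiftEntries z s l).length = l.length := by
  induction l with
  | nil => rfl
  | cons _ l ih => simp [shiftEntries, ih]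

theorem nonempty_equiv_fin_succ_iff {B C : Type} (e : Unit ⊕ B ≃ C) (n : ℕ) :
    Nonempty (C ≃ Fin (n + 1)) ↔ Nonempty (B ≃ Fin n) := by
  have e' : Option B ≃ C := ((Equiv.optionEquivSumPUnit B).trans (Equiv.sumComm B Unit)).trans e
  constructor
  · rintro ⟨f⟩
    exact ⟨((e'.trans f).trans (finSuccEquiv n)).removeNone⟩
  · rintro ⟨f⟩
    exact ⟨(e'.symm.trans f.optionCongr).trans (finSuccEquiv n).symm⟩

/-- Recursive vectors over a counting algebra. -/
theorem recursive_vectors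
    (A : Type) (z : A) (s : A → A) (C : A → Type)
    (hCz : IsEmpty (C z))
    (min max : ∀ x : A, C (s x)) (upp low : ∀ x : A, C x → C (s x))
    (hmin : ∀ x : A, Function.Bijective
      (Sum.elim (fun _ : Unit => min x) (upp x) : Unit ⊕ C x → C (s x)))
    (hmax : ∀ x : A, Function.Bijective
      (Sum.elim (low x) (fun _ : Unit => max x) : C x ⊕ Unit → C (s x)))
    (hne : ∀ x : A, min (s x) ≠ max (s x)) :
    ∃ (M : A → Type),
      (Nonempty (M z) ∧ Subsingleton (M z)) ∧
      ∃ (pair : ∀ x : A, M x × A → M (s x)),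
        (∀ x : A, Function.Bijective (pair x)) ∧
        ∃ (last : ∀ x : A, M x → Unit ⊕ A),
          (∀ m : M z, last z m = Sum.inl ()) ∧
          (∀ (x : A) (m : M x) (y : A), last (s x) (pair x (m, y)) = Sum.inr y) ∧
          ∃ (rest : ∀ x : A, M x → M x),
            ∀ (x : A) (m : M x) (y : A),
              rest (s x) (pair x (m, y)) =
                pair x (rest x m, Sum.elim (fun _ : Unit => z) s (last x m)) := by
  have key (x : A) (n : ℕ) : Nonempty (C (s x) ≃ Fin (n + 1)) ↔ Nonempty (C x ≃ Fin n) :=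
    nonempty_equiv_fin_succ_iff (Equiv.ofBijective _ (hmin x)) n
  have nil_of_zero (m : {l : List A // Nonempty (C z ≃ Fin l.length)}) : m.1 = [] := by
    obtain ⟨l, ⟨f⟩⟩ := m
    cases l with
    | nil => rfl
    | cons y l => exact (hCz.false (f.symm ⟨0, Nat.succ_pos _⟩)).elim
  refine ⟨fun x => {l : List A // Nonempty (C x ≃ Fin l.length)},
    ⟨⟨⟨[], ⟨Equiv.equivOfIsEmpty (C z) (Fin 0)⟩⟩⟩, ⟨fun a b => Subtype.ext ?_⟩⟩,
    fun x p => ⟨p.2 :: p.1.1, (key x _).2 p.1.2⟩, fun x => ⟨?_, ?_⟩,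
    fun x m => lastEntry m.1, fun m => ?_, fun _ _ _ => rfl,
    fun x m => ⟨shiftEntries z s m.1, (length_shiftEntries z s m.1).symm ▸ m.2⟩,
    fun _ _ _ => rfl⟩
  · rw [nil_of_zero a, nil_of_zero b]
  · rintro ⟨⟨l, hl⟩, y⟩ ⟨⟨l', hl'⟩, y'⟩ h
    obtain ⟨rfl, rfl⟩ := List.cons.inj (congrArg Subtype.val h)
    rfl
  · rintro ⟨l, hl⟩
    cases l with
    | nil => exact hl.elim fun f => (f (min x)).elim0
    | cons y l => exact ⟨(⟨l, (key x _).1 hl⟩, y), rfl⟩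
  · exact congrArg lastEntry (nil_of_zero m)
end

section
/- Stable embedding into the integers: let (Z, z₀, S) be an initial integer algebra. Then there exist a stable natural number algebra (N, zN, sN) and an injective function j : N → Z such that j zN = z₀ and j (sN n) = S (j n) for all n : N. -/
/-- Stable embedding into the integers: an initial integer algebra contains a
stable natural number algebra via an injective algebra map. -/
theorem stable_embedding
    (Z : Type) (z₀ : Z) (S : Z → Z) (hS : Function.Bijective S)
    (init : ∀ (B : Type) (b : B) (e : B → B), Function.Bijective e →
      ∃! f : Z → B, f z₀ = b ∧ ∀ x : Z, f (S x) = e (f x)) :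
    ∃ (N : Type) (zN : N) (sN : N → N),
      Function.Bijective (Sum.elim (fun _ : Unit => zN) sN : Unit ⊕ N → N) ∧
      ∃ j : N → Z, Function.Injective j ∧ j zN = z₀ ∧
        ∀ n : N, j (sN n) = S (j n) := by
  obtain ⟨f, ⟨hf₀, hf⟩, -⟩ := init ℤ 0 (· + 1) (Equiv.addRight (1 : ℤ)).bijective
  have hiter : ∀ n : ℕ, f (S^[n] z₀) = n := by
    intro n
    induction n with
    | zero => simpa using hf₀
    | succ n ih => rw [Function.iterate_succ_apply', hf, ih, Nat.cast_succ]
  refine ⟨ℕ, 0, Nat.succ, ⟨?_, ?_⟩, fun n => S^[n] z₀, ?_, rfl,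
    fun n => Function.iterate_succ_apply' S n z₀⟩
  · rintro (_ | m) (_ | n) h <;> simp_all
  · rintro (_ | n)
    · exact ⟨Sum.inl (), rfl⟩
    · exact ⟨Sum.inr n, rfl⟩
  · intro m n h
    have hmn : (m : ℤ) = n := by rw [← hiter m, ← hiter n]; exact congrArg f h
    exact_mod_cast hmn
end

section
/- Stable implies initial over the integers: let (Z, z₀, S) be an initial integer algebra, A : Z → Type a family, za : A z₀, and sa : ∀ x, A x → A (S x). Suppose A z₀ has exactly one element and the natural number algebra with carrier Σ x : Z, A x, zero element ⟨z₀, za⟩, and successor sending ⟨x, a⟩ to ⟨S x, sa x a⟩ is stable. Then this natural number algebra is initial. -/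
/-- An initial integer algebra embeds into the integers compatibly with its structure. -/
theorem exists_injective_int_of_initial {Z : Type} {z₀ : Z} {S : Z → Z}
    (hS : Function.Bijective S)
    (init : ∀ (B : Type) (b : B) (e : B → B), Function.Bijective e →
      ∃! f : Z → B, f z₀ = b ∧ ∀ x : Z, f (S x) = e (f x)) :
    ∃ h : Z → ℤ, Function.Injective h ∧ h z₀ = 0 ∧ ∀ x, h (S x) = h x + 1 := by
  obtain ⟨h, ⟨h_zero, h_succ⟩, -⟩ := init ℤ 0 (· + 1) (Equiv.addRight (1 : ℤ)).bijective
  let e : Equiv.Perm Z := Equiv.ofBijective S hS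
  have h_left : (fun x => (e ^ h x) z₀) = id :=
    (init Z z₀ S hS).unique
      ⟨by simp [h_zero], fun x => by
        rw [h_succ, add_comm, zpow_one_add, Equiv.Perm.mul_apply]
        rfl⟩
      ⟨rfl, fun _ => rfl⟩
  exact ⟨h, Function.LeftInverse.injective (g := fun n : ℤ => (e ^ n) z₀) (congrFun h_left),
    h_zero, h_succ⟩

section Graded

variable {T : Type*} {z : T} {s : T → T} {d : T → ℤ}

/-- If `z` is the only element of degree zero and is not a successor, then no element has
negative degree. -/
theorem degree_nonneg_of_stable (hd : ∀ p, d (s p) = d p + 1)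
    (h_zero : ∀ p, d p = 0 → p = z) (h_ne : ∀ p, s p ≠ z) (p : T) : 0 ≤ d p := by
  have h_neg : ∀ (n : ℕ) (p : T), d p ≠ -(n + 1 : ℤ) := by
    intro n
    induction n with
    | zero =>
      intro p hp
      exact h_ne p (h_zero _ (by rw [hd, hp]; simp))
    | succ n ih =>
      intro p hp
      exact ih (s p) (by rw [hd, hp]; push_cast; ring)
  by_contra! hp
  exact h_neg (-d p - 1).toNat p (by omega)

/-- The induction principle for a graded stable natural number algebra in which `z` is the only
element of degree zero. -/
theorem induction_of_stable (hd : ∀ p, d (s p) = d p + 1)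
    (h_zero : ∀ p, d p = 0 → p = z) (h_ne : ∀ p, s p ≠ z)
    (h_cases : ∀ p, p = z ∨ ∃ q, s q = p) {P : T → Prop} (base : P z)
    (step : ∀ p, P p → P (s p)) (p : T) : P p := by
  obtain ⟨n, hn⟩ := Int.eq_ofNat_of_zero_le (degree_nonneg_of_stable hd h_zero h_ne p)
  induction n generalizing p with
  | zero => exact h_zero p hn ▸ base
  | succ n ih =>
    obtain rfl | ⟨q, rfl⟩ := h_cases p
    · exact base
    · exact step q (ih q (by rw [hd] at hn; push_cast at hn; omega))

end Graded


/-- Stable implies initial over the integers. -/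
theorem stable_to_initial
    (Z : Type) (z₀ : Z) (S : Z → Z) (hS : Function.Bijective S)
    (init : ∀ (B : Type) (b : B) (e : B → B), Function.Bijective e →
      ∃! f : Z → B, f z₀ = b ∧ ∀ x : Z, f (S x) = e (f x))
    (A : Z → Type) (za : A z₀) (sa : ∀ x : Z, A x → A (S x))
    (hunique : ∀ a : A z₀, a = za)
    (hstable : Function.Bijective
      (Sum.elim (fun _ : Unit => (⟨z₀, za⟩ : Σ x : Z, A x))
        (fun p : Σ x : Z, A x => ⟨S p.1, sa p.1 p.2⟩) :
        Unit ⊕ (Σ x : Z, A x) → Σ x : Z, A x)) :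
    ∀ (B : Type) (b : B) (g : B → B),
      ∃! f : (Σ x : Z, A x) → B,
        f ⟨z₀, za⟩ = b ∧
        ∀ p : Σ x : Z, A x, f ⟨S p.1, sa p.1 p.2⟩ = g (f p) := by
  obtain ⟨h, h_inj, h_zero, h_succ⟩ := exists_injective_int_of_initial hS init
  let z : Σ x : Z, A x := ⟨z₀, za⟩
  let s : (Σ x : Z, A x) → Σ x : Z, A x := fun p => ⟨S p.1, sa p.1 p.2⟩
  let d : (Σ x : Z, A x) → ℤ := fun p => h p.1
  have hd : ∀ p, d (s p) = d p + 1 := fun p => h_succ p.1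
  have hd_zero : ∀ p, d p = 0 → p = z := by
    rintro ⟨x, a⟩ hp
    obtain rfl : x = z₀ := h_inj (hp.trans h_zero.symm)
    rw [hunique a]
  have h_ne : ∀ p, s p ≠ z := fun p hp => by
    have := @hstable.1 (Sum.inr p) (Sum.inl ()) hp
    contradiction
  have h_cases : ∀ p, p = z ∨ ∃ q, s q = p := by
    intro p
    obtain ⟨_ | q, hq⟩ := hstable.2 p
    · exact Or.inl hq.symm
    · exact Or.inr ⟨q, hq⟩
  intro B b g
  refine ⟨fun p => g^[(d p).toNat] b, ⟨?_, fun p => ?_⟩, fun f hf => funext fun p => ?_⟩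
  · simp [d, h_zero]
  · change g^[(d (s p)).toNat] b = _
    rw [hd, Int.toNat_add (degree_nonneg_of_stable hd hd_zero h_ne p) zero_le_one]
    exact Function.iterate_succ_apply' g _ b
  · refine induction_of_stable hd hd_zero h_ne h_cases
      (P := fun p => f p = g^[(d p).toNat] b) ?_ (fun p ih => ?_) p
    · simpa [d, z, h_zero] using hf.1
    · rw [hd, Int.toNat_add (degree_nonneg_of_stable hd hd_zero h_ne p) zero_le_one]
      exact (hf.2 p).trans ((congrArg g ih).trans (Function.iterate_succ_apply' g _ b).symm)
end

section
/- Decomposition of the integers from a pair of halves: let (Z, z₀, S) be an initial integer algebra, let A and B be types with a bijection e : A → B ⊕ A, and let b : B. Then there exists a function σ : Z → Fin 3 such that σ z₀ = 1, the image under S of {x : Z | σ x = 0} equals {x : Z | σ x = 0 ∨ σ x = 1}, and the image under S of {x : Z | σ x = 1 ∨ σ x = 2} equals {x : Z | σ x = 2}. -/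
/-- Decomposition of the integers from a pair of halves. -/
theorem int_decomposition_from_halves
    (Z : Type) (z₀ : Z) (S : Z → Z) (hS : Function.Bijective S)
    (init : ∀ (B : Type) (b : B) (e : B → B), Function.Bijective e →
      ∃! f : Z → B, f z₀ = b ∧ ∀ x : Z, f (S x) = e (f x))
    (A B : Type) (e : A → B ⊕ A) (he : Function.Bijective e) (b : B) :
    ∃ σ : Z → Fin 3,
      σ z₀ = 1 ∧
      S '' {x : Z | σ x = 0} = {x : Z | σ x = 0 ∨ σ x = 1} ∧
      S '' {x : Z | σ x = 1 ∨ σ x = 2} = {x : Z | σ x = 2} := by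
  obtain ⟨f, ⟨hf₀, hf⟩, -⟩ := init ℤ 0 (· + 1) (Equiv.addRight (1 : ℤ)).bijective
  refine ⟨fun x => if f x < 0 then 0 else if f x = 0 then 1 else 2, by simp [hf₀], ?_, ?_⟩
  all_goals
    ext x
    obtain ⟨y, rfl⟩ := hS.surjective x
    rw [hS.injective.mem_set_image]
    simp only [Set.mem_ofPred_eq, hf]
    split_ifs <;> omega
end
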